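/- arXiv:2309.04610 — 2 statements merged into one kernel-verified Lean document; each statement's English description precedes it below -/
import Mathlib

section
/- Fix t ∈ ℝ with t ≠ 0, let U ⊆ ℝ⁴ be an open set, and let f : ℝ⁴ → ℍ_t be twice continuously differentiable on U. If f is left t-regular on U, i.e. ∇_t f = 0 on U, then f is t-harmonic on U, i.e. Δ_t f = ∂₁²f + ∂₂²f − sgn(t)·∂₃²f − sgn(t)·∂₄²f = 0 on U. -/
/-- The `t`-scaled hypercomplex multiplication on `ℂ × ℂ`. -/
noncomputable def hmul (t : ℝ) (h₁ h₂ : ℂ × ℂ) : ℂ × ℂ :=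
  (h₁.1 * h₂.1 + (t : ℂ) * h₁.2 * (starRingEnd ℂ) h₂.2,
   h₁.1 * h₂.2 + h₁.2 * (starRingEnd ℂ) h₂.1)

/-- The element `1 = (1,0)` of `ℍ_t`. -/
noncomputable def oneH : ℂ × ℂ := (1, 0)

/-- The element `i = (i_ℂ, 0)` of `ℍ_t`. -/
noncomputable def iH : ℂ × ℂ := (Complex.I, 0)

/-- The element `j_t = (0,1)` of `ℍ_t`. -/
noncomputable def jH : ℂ × ℂ := (0, 1)

/-- The element `k_t = (0, i_ℂ)` of `ℍ_t`. -/
noncomputable def kH : ℂ × ℂ := (0, Complex.I)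

/-- The partial derivative of `f : ℝ⁴ → ℍ_t` in the `l`-th coordinate
direction. -/
noncomputable def pd (l : Fin 4) (f : (Fin 4 → ℝ) → ℂ × ℂ) :
    (Fin 4 → ℝ) → ℂ × ℂ :=
  fun x => fderiv ℝ f x (Pi.single l 1)

/-- The operator `∇_t f = ∂₁f + i·∂₂f − (s/ρ)·j_t·∂₃f − (s/ρ)·k_t·∂₄f`,
with `s = sgn t`, `ρ = √|t|`, constants multiplying from the left in `ℍ_t`. -/
noncomputable def nablaL (t : ℝ) (f : (Fin 4 → ℝ) → ℂ × ℂ) :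
    (Fin 4 → ℝ) → ℂ × ℂ :=
  fun x => pd 0 f x + hmul t iH (pd 1 f x)
    - (Real.sign t / Real.sqrt |t|) • hmul t jH (pd 2 f x)
    - (Real.sign t / Real.sqrt |t|) • hmul t kH (pd 3 f x)

/-- The operator `∇_t† f = ∂₁f − i·∂₂f + (s/ρ)·j_t·∂₃f + (s/ρ)·k_t·∂₄f`. -/
noncomputable def nablaD (t : ℝ) (f : (Fin 4 → ℝ) → ℂ × ℂ) :
    (Fin 4 → ℝ) → ℂ × ℂ :=
  fun x => pd 0 f x - hmul t iH (pd 1 f x)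
    + (Real.sign t / Real.sqrt |t|) • hmul t jH (pd 2 f x)
    + (Real.sign t / Real.sqrt |t|) • hmul t kH (pd 3 f x)

/-- The right-hand operator
`f∇_t = ∂₁f + ∂₂f·i − (s/ρ)·∂₃f·j_t − (s/ρ)·∂₄f·k_t`,
with constants multiplying from the right in `ℍ_t`. -/
noncomputable def nablaR (t : ℝ) (f : (Fin 4 → ℝ) → ℂ × ℂ) :
    (Fin 4 → ℝ) → ℂ × ℂ :=
  fun x => pd 0 f x + hmul t (pd 1 f x) iH
    - (Real.sign t / Real.sqrt |t|) • hmul t (pd 2 f x) jH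
    - (Real.sign t / Real.sqrt |t|) • hmul t (pd 3 f x) kH

/-- The `t`-scaled Laplacian `Δ_t f = ∂₁²f + ∂₂²f − sgn(t)·∂₃²f − sgn(t)·∂₄²f`. -/
noncomputable def lapT (t : ℝ) (f : (Fin 4 → ℝ) → ℂ × ℂ) :
    (Fin 4 → ℝ) → ℂ × ℂ :=
  fun x => pd 0 (pd 0 f) x + pd 1 (pd 1 f) x
    - Real.sign t • pd 2 (pd 2 f) x - Real.sign t • pd 3 (pd 3 f) x

/-- Left multiplication by a constant of `ℍ_t`, as a continuous `ℝ`-linear map. -/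
noncomputable def hmulLeft (t : ℝ) (a : ℂ × ℂ) : ℂ × ℂ →L[ℝ] ℂ × ℂ :=
  LinearMap.toContinuousLinearMap
    { toFun := hmul t a
      map_add' := fun x y => by
        ext1 <;> simp only [hmul, Prod.fst_add, Prod.snd_add, map_add] <;> ring
      map_smul' := fun r x => by
        ext1 <;> simp only [hmul, Prod.smul_fst, Prod.smul_snd, Complex.real_smul, map_mul,
          Complex.conj_ofReal, RingHom.id_apply] <;> ring }

theorem differentiableAt_pd {f : (Fin 4 → ℝ) → ℂ × ℂ} {x : Fin 4 → ℝ}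
    (hf : ContDiffAt ℝ 2 f x) (l : Fin 4) : DifferentiableAt ℝ (pd l f) x :=
  ((hf.fderiv_right (m := 1) (by norm_num)).differentiableAt (by norm_num)).clm_apply
    (differentiableAt_const _)

theorem pd_pd_apply {f : (Fin 4 → ℝ) → ℂ × ℂ} {x : Fin 4 → ℝ}
    (hf : ContDiffAt ℝ 2 f x) (m l : Fin 4) :
    pd m (pd l f) x = fderiv ℝ (fderiv ℝ f) x (Pi.single m 1) (Pi.single l 1) := by
  have hd := (hf.fderiv_right (m := 1) (by norm_num)).differentiableAt (by norm_num)
  unfold pd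
  rw [fderiv_clm_apply hd (differentiableAt_const _)]
  simp

theorem pd_pd_comm {f : (Fin 4 → ℝ) → ℂ × ℂ} {x : Fin 4 → ℝ}
    (hf : ContDiffAt ℝ 2 f x) (m l : Fin 4) : pd m (pd l f) x = pd l (pd m f) x := by
  rw [pd_pd_apply hf, pd_pd_apply hf]
  exact (hf.isSymmSndFDerivAt (by simp)).eq _ _

theorem pd_nablaL (t : ℝ) {f : (Fin 4 → ℝ) → ℂ × ℂ} {x : Fin 4 → ℝ}
    (hf : ContDiffAt ℝ 2 f x) (m : Fin 4) :
    pd m (nablaL t f) x = pd m (pd 0 f) x + hmul t iH (pd m (pd 1 f) x)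
      - (Real.sign t / Real.sqrt |t|) • hmul t jH (pd m (pd 2 f) x)
      - (Real.sign t / Real.sqrt |t|) • hmul t kH (pd m (pd 3 f) x) := by
  have hd := fun l => (differentiableAt_pd hf l).hasFDerivAt
  have hc := fun a l => (hmulLeft t a).hasFDerivAt.comp x (hd l)
  have h := (((hd 0).add (hc iH 1)).sub ((hc jH 2).const_smul (Real.sign t / Real.sqrt |t|))).sub
    ((hc kH 3).const_smul (Real.sign t / Real.sqrt |t|))
  exact congrArg (fun L => L (Pi.single m 1)) (HasFDerivAt.fderiv (f := nablaL t f) h)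

theorem sign_div_sqrt_abs_sq_mul {t : ℝ} (ht : t ≠ 0) :
    (Real.sign t / Real.sqrt |t|) ^ 2 * t = Real.sign t := by
  rw [div_pow, Real.sq_sqrt (abs_nonneg t)]
  rcases ht.lt_or_gt with h | h
  · rw [Real.sign_of_neg h, abs_of_neg h]
    field_simp
  · rw [Real.sign_of_pos h, abs_of_pos h]
    field_simp

/-- The factorization `∇_t† ∇_t = Δ_t` on twice continuously differentiable functions. -/
theorem nablaD_nablaL {t : ℝ} (ht : t ≠ 0) {f : (Fin 4 → ℝ) → ℂ × ℂ} {x : Fin 4 → ℝ}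
    (hf : ContDiffAt ℝ 2 f x) : nablaD t (nablaL t f) x = lapT t f x := by
  have hs : ((Real.sign t / Real.sqrt |t| : ℝ) : ℂ) ^ 2 * t = (Real.sign t : ℝ) := by
    exact_mod_cast sign_div_sqrt_abs_sq_mul ht
  simp only [nablaD, lapT, pd_nablaL t hf]
  rw [pd_pd_comm hf 1 0, pd_pd_comm hf 2 0, pd_pd_comm hf 3 0, pd_pd_comm hf 2 1,
    pd_pd_comm hf 3 1, pd_pd_comm hf 3 2]
  generalize Real.sign t / Real.sqrt |t| = c at *
  ext1 <;>
  simp only [hmul, iH, jH, kH, map_zero, map_one, Prod.fst_add, Prod.snd_add,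
    Prod.fst_sub, Prod.snd_sub,
    Prod.smul_fst, Prod.smul_snd, Complex.real_smul, map_add, map_sub, map_mul,
    Complex.conj_ofReal, Complex.conj_conj, Complex.conj_I, ← hs] <;>
  ring_nf <;> simp only [Complex.I_sq] <;> ring

/-- For `t ≠ 0`, `U ⊆ ℝ⁴` open, and `f` twice continuously differentiable on
`U`: if `f` is left `t`-regular on `U` (`∇_t f = 0` on `U`), then `f` is
`t`-harmonic on `U` (`Δ_t f = 0` on `U`). -/
theorem left_t_regular_implies_t_harmonic (t : ℝ) (ht : t ≠ 0)
    (U : Set (Fin 4 → ℝ)) (hU : IsOpen U)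
    (f : (Fin 4 → ℝ) → ℂ × ℂ) (hf : ContDiffOn ℝ 2 f U)
    (hreg : ∀ x ∈ U, nablaL t f x = 0) :
    ∀ x ∈ U, lapT t f x = 0 := by
  intro x hx
  rw [← nablaD_nablaL ht (hf.contDiffAt (hU.mem_nhds hx))]
  have hz : nablaL t f =ᶠ[nhds x] fun _ => 0 := by
    filter_upwards [hU.mem_nhds hx] with y hy using hreg y hy
  have hp : ∀ l, pd l (nablaL t f) x = 0 := fun l => by
    simp [pd, hz.fderiv_eq]
  simp [nablaD, hp, hmul]
end

section
/- Let t = 0 and let f : ℝ⁴ → ℍ₀ be twice continuously differentiable. Then ∇₀†(∇₀ f) = ∂₁²f + ∂₂²f; that is, the composition ∇₀†∇₀ equals the 0-scaled Laplacian Δ₀ = ∂₁² + ∂₂². -/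
/-- The `0`-scaled hypercomplex multiplication on `ℂ × ℂ`:
`(a₁,b₁) ·₀ (a₂,b₂) = (a₁a₂, a₁b₂ + b₁·conj(a₂))`. -/
noncomputable def hmul0 (h₁ h₂ : ℂ × ℂ) : ℂ × ℂ :=
  (h₁.1 * h₂.1, h₁.1 * h₂.2 + h₁.2 * (starRingEnd ℂ) h₂.1)

/-- The operator `∇₀ f = ∂₁f + i·∂₂f + j₀·∂₃f + k₀·∂₄f`, constants
multiplying from the left in `ℍ₀`. -/
noncomputable def nabla0 (f : (Fin 4 → ℝ) → ℂ × ℂ) : (Fin 4 → ℝ) → ℂ × ℂ :=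
  fun x => pd 0 f x + hmul0 iH (pd 1 f x) + hmul0 jH (pd 2 f x)
    + hmul0 kH (pd 3 f x)

/-- The operator `∇₀† f = ∂₁f − i·∂₂f − j₀·∂₃f − k₀·∂₄f`. -/
noncomputable def nabla0D (f : (Fin 4 → ℝ) → ℂ × ℂ) : (Fin 4 → ℝ) → ℂ × ℂ :=
  fun x => pd 0 f x - hmul0 iH (pd 1 f x) - hmul0 jH (pd 2 f x)
    - hmul0 kH (pd 3 f x)

/-- The right-hand operator `f∇₀ = ∂₁f + ∂₂f·i + ∂₃f·j₀ + ∂₄f·k₀`. -/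
noncomputable def nabla0R (f : (Fin 4 → ℝ) → ℂ × ℂ) : (Fin 4 → ℝ) → ℂ × ℂ :=
  fun x => pd 0 f x + hmul0 (pd 1 f x) iH + hmul0 (pd 2 f x) jH
    + hmul0 (pd 3 f x) kH

/-- The `0`-scaled Laplacian `Δ₀ f = ∂₁²f + ∂₂²f`. -/
noncomputable def lap0 (f : (Fin 4 → ℝ) → ℂ × ℂ) : (Fin 4 → ℝ) → ℂ × ℂ :=
  fun x => pd 0 (pd 0 f) x + pd 1 (pd 1 f) x

/-- Left multiplication by a constant of `ℍ₀`, as a real continuous linear map. -/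
noncomputable def hmul0CLM (c : ℂ × ℂ) : (ℂ × ℂ) →L[ℝ] (ℂ × ℂ) :=
  LinearMap.toContinuousLinearMap
    { toFun := hmul0 c
      map_add' := fun x y => by
        ext1 <;> simp only [hmul0, Prod.fst_add, Prod.snd_add, map_add] <;> ring
      map_smul' := fun r x => by
        ext1 <;> simp only [hmul0, Prod.smul_fst, Prod.smul_snd, Complex.real_smul, map_mul,
          Complex.conj_ofReal, RingHom.id_apply] <;> ring }

theorem pd_add (l : Fin 4) {f g : (Fin 4 → ℝ) → ℂ × ℂ} (hf : Differentiable ℝ f)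
    (hg : Differentiable ℝ g) (x : Fin 4 → ℝ) :
    pd l (fun y => f y + g y) x = pd l f x + pd l g x := by
  simp only [pd]
  rw [fderiv_fun_add (hf x) (hg x)]
  rfl

theorem differentiable_hmul0 (c : ℂ × ℂ) {f : (Fin 4 → ℝ) → ℂ × ℂ} (hf : Differentiable ℝ f) :
    Differentiable ℝ fun y => hmul0 c (f y) :=
  (hmul0CLM c).differentiable.comp hf

theorem pd_hmul0 (l : Fin 4) (c : ℂ × ℂ) {f : (Fin 4 → ℝ) → ℂ × ℂ} (hf : Differentiable ℝ f)
    (x : Fin 4 → ℝ) : pd l (fun y => hmul0 c (f y)) x = hmul0 c (pd l f x) := by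
  have h := ((hmul0CLM c).hasFDerivAt.comp x (hf x).hasFDerivAt).fderiv
  exact congrArg (fun L => L (Pi.single l 1)) h

theorem differentiable_pd (l : Fin 4) {f : (Fin 4 → ℝ) → ℂ × ℂ} (hf : ContDiff ℝ 2 f) :
    Differentiable ℝ (pd l f) :=
  ((hf.fderiv_right (m := 1) (by norm_num)).differentiable (by norm_num)).clm_apply
    (differentiable_const _)

theorem pd_pd (l m : Fin 4) {f : (Fin 4 → ℝ) → ℂ × ℂ} (hf : ContDiff ℝ 2 f) (x : Fin 4 → ℝ) :
    pd l (pd m f) x = fderiv ℝ (fderiv ℝ f) x (Pi.single l 1) (Pi.single m 1) := by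
  have hd : DifferentiableAt ℝ (fderiv ℝ f) x :=
    (hf.fderiv_right (m := 1) (by norm_num)).differentiable (by norm_num) x
  have h := (hd.hasFDerivAt.clm_apply
    (hasFDerivAt_const (Pi.single m 1 : Fin 4 → ℝ) x)).fderiv
  change fderiv ℝ (fun y => fderiv ℝ f y (Pi.single m 1)) x (Pi.single l 1) = _
  simpa using congrArg (fun L => L (Pi.single l 1)) h

/-- Symmetry of second partial derivatives. -/
theorem pd_comm (l m : Fin 4) {f : (Fin 4 → ℝ) → ℂ × ℂ} (hf : ContDiff ℝ 2 f) (x : Fin 4 → ℝ) :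
    pd l (pd m f) x = pd m (pd l f) x := by
  rw [pd_pd l m hf, pd_pd m l hf]
  exact (hf.contDiffAt.isSymmSndFDerivAt (by simp)) _ _

theorem pd_nabla0 (l : Fin 4) {f : (Fin 4 → ℝ) → ℂ × ℂ} (hf : ContDiff ℝ 2 f) (x : Fin 4 → ℝ) :
    pd l (nabla0 f) x = pd l (pd 0 f) x + hmul0 iH (pd l (pd 1 f) x)
      + hmul0 jH (pd l (pd 2 f) x) + hmul0 kH (pd l (pd 3 f) x) := by
  have d := fun m => differentiable_pd m hf
  have e := fun c m => differentiable_hmul0 c (d m)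
  unfold nabla0
  rw [pd_add l (((d 0).fun_add (e iH 1)).fun_add (e jH 2)) (e kH 3),
    pd_add l ((d 0).fun_add (e iH 1)) (e jH 2), pd_add l (d 0) (e iH 1),
    pd_hmul0 l iH (d 1), pd_hmul0 l jH (d 2), pd_hmul0 l kH (d 3)]

/-- For `f : ℝ⁴ → ℍ₀` twice continuously differentiable,
`∇₀†(∇₀ f) = ∂₁²f + ∂₂²f = Δ₀ f`. -/
theorem nabla0D_nabla0_eq_lap0 (f : (Fin 4 → ℝ) → ℂ × ℂ)
    (hf : ContDiff ℝ 2 f) :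
    ∀ x, nabla0D (nabla0 f) x = lap0 f x := by
  intro x
  rw [nabla0D, lap0, pd_nabla0 0 hf, pd_nabla0 1 hf, pd_nabla0 2 hf, pd_nabla0 3 hf,
    pd_comm 1 0 hf, pd_comm 2 0 hf, pd_comm 3 0 hf, pd_comm 2 1 hf, pd_comm 3 1 hf,
    pd_comm 3 2 hf]
  ext1
  · simp only [hmul0, iH, jH, kH, Prod.fst_add, Prod.fst_sub]
    linear_combination (-(pd 1 (pd 1 f) x).1) * Complex.I_mul_I
  · simp only [hmul0, iH, jH, kH, Prod.fst_add, Prod.snd_add, Prod.snd_sub,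
      map_add, map_mul, map_zero, Complex.conj_I]
    linear_combination (-(pd 1 (pd 1 f) x).2) * Complex.I_mul_I
end
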